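/- Exact fourth moment of a centered weighted sum of squares: Let Z_1, …, Z_n be random variables such that, for all positive integers m_1, …, m_r with m_1 + ⋯ + m_r ≤ 4, the mixed moment β_{2m_1,…,2m_r} := E[Z_{i_1}^{2m_1} Z_{i_2}^{2m_2} ⋯ Z_{i_r}^{2m_r}] (for distinct indices i_1, …, i_r) is finite and invariant under permutations of the indices. Then for any real numbers a_1, …, a_n with a_1 + ⋯ + a_n = 1, writing S_j = a_1^j + ⋯ + a_n^j, one has E[(∑_{k=1}^n a_k (Z_k^2 − E[Z_k^2]))^4] = S_4 β_8 + 4(S_3 − S_4) β_{6,2} − 4 S_3 β_2 β_6 + 3(S_2^2 − S_4) β_{4,4} + 6(S_2 − S_2^2 − 2S_3 + 2S_4) β_{4,2,2} + 12(−S_2 + S_3) β_2 β_{4,2} + 4(3S_2 − 2S_3 − 1) β_2 β_{2,2,2} + (−6S_2 + 3S_2^2 + 8S_3 − 6S_4 + 1) β_{2,2,2,2} + 6(1 − S_2) β_2^2 β_{2,2} + 6 S_2 β_2^2 β_4 − 3 β_2^4. -/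

import Mathlib

open MeasureTheory Filter Finset

noncomputable section

variable {Ω : Type*} [MeasurableSpace Ω]

/-- `mom P Z [m₁, …, m_r]` is the mixed moment `β_{2m₁,…,2m_r} = E[Z_{i₁}^{2m₁} ⋯ Z_{i_r}^{2m_r}]`
computed with the distinct indices `i₁ = 0, …, i_r = r−1`; coordinates of `Z` beyond the list
get exponent `0`.  (Under the permutation-invariance hypothesis the choice of distinct indices
is irrelevant.) -/
def mom {n : ℕ} (P : Measure Ω) (Z : Fin n → Ω → ℝ) (e : List ℕ) : ℝ :=
  ∫ ω, ∏ i : Fin n, Z i ω ^ (2 * e.getD i.val 0) ∂P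

/-- `S_j = a₁^j + ⋯ + a_n^j`. -/
def Spow {n : ℕ} (a : Fin n → ℝ) (j : ℕ) : ℝ := ∑ i, a i ^ j

theorem aux_prod {n r : ℕ} (f : Fin r → Fin n) (e : Fin r → ℕ) (x : Fin n → ℝ) :
    ∏ i, x i ^ (2 * ∑ t, if f t = i then e t else 0) = ∏ t, (x (f t)) ^ (2 * e t) := by
  simp_rw [Finset.mul_sum, ← Finset.prod_pow_eq_pow_sum]
  rw [Finset.prod_comm]
  refine Finset.prod_congr rfl fun t _ => ?_
  rw [Finset.prod_eq_single (f t)]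
  · simp
  · intro b _ hb
    simp [hb.symm]
  · simp

theorem aux_sum {n r : ℕ} (f : Fin r → Fin n) (e : Fin r → ℕ) :
    ∑ i, (∑ t, if f t = i then e t else 0) = ∑ t, e t := by
  rw [Finset.sum_comm]
  simp

theorem aux_int {n r : ℕ} (P : Measure Ω) (Z : Fin n → Ω → ℝ)
    (hInt : ∀ m : Fin n → ℕ, (∑ i, m i) ≤ 4 →
      Integrable (fun ω => ∏ i, Z i ω ^ (2 * m i)) P)
    (f : Fin r → Fin n) (hr : r ≤ 4) :
    Integrable (fun ω => ∏ t, Z (f t) ω ^ 2) P := by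
  have h := hInt (fun i => ∑ t, if f t = i then 1 else 0)
    (by rw [aux_sum f (fun _ => 1)]; simpa using hr)
  refine h.congr (Filter.Eventually.of_forall fun ω => ?_)
  simpa using aux_prod f (fun _ => 1) (fun i => Z i ω)

theorem aux_mom {n r : ℕ} (P : Measure Ω) (Z : Fin n → Ω → ℝ)
    (hPerm : ∀ (m : Fin n → ℕ) (σ : Equiv.Perm (Fin n)), (∑ i, m i) ≤ 4 →
      ∫ ω, ∏ i, Z i ω ^ (2 * m i) ∂P = ∫ ω, ∏ i, Z i ω ^ (2 * m (σ i)) ∂P)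
    (f : Fin r → Fin n) (hf : Function.Injective f) (e : Fin r → ℕ) (he : ∑ t, e t ≤ 4) :
    ∫ ω, ∏ t, Z (f t) ω ^ (2 * e t) ∂P = mom P Z (List.ofFn e) := by
  have hrn : r ≤ n := by simpa using Fintype.card_le_of_injective f hf
  obtain ⟨σ, hσ⟩ : ∃ σ : Equiv.Perm (Fin n), ∀ t, σ (f t) = Fin.castLE hrn t := by
    let A := (Equiv.ofInjective f hf).symm.trans
      (Equiv.ofInjective (Fin.castLE hrn) (Fin.castLE_injective hrn))
    refine ⟨A.extendSubtype, fun t => ?_⟩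
    rw [Equiv.extendSubtype_apply_of_mem A (f t) ⟨t, rfl⟩]
    have : (⟨f t, ⟨t, rfl⟩⟩ : {x // x ∈ Set.range f}) = Equiv.ofInjective f hf t := rfl
    simp only [A, Equiv.trans_apply]
    erw [this, Equiv.symm_apply_apply]
    rfl
  set m : Fin n → ℕ := fun i => ∑ t, if Fin.castLE hrn t = i then e t else 0 with hm
  have h1 : ∀ i : Fin n, (List.ofFn e).getD i.val 0 = m i := by
    intro i
    by_cases hi : i.val < r
    · rw [hm]
      simp only
      rw [Finset.sum_eq_single ⟨i.val, hi⟩]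
      · simp [List.getD, hi]
      · intro b _ hb
        rw [if_neg]
        intro h
        apply hb
        ext
        simp [← h]
      · simp
    · rw [hm]
      simp only
      rw [Finset.sum_eq_zero]
      · simp [List.getD, hi]
      · intro b _
        rw [if_neg]
        intro h
        apply hi
        rw [← h]
        simp
  have h2 : ∀ i, m (σ i) = ∑ t, if f t = i then e t else 0 := by
    intro i
    rw [hm]
    simp only
    refine Finset.sum_congr rfl fun t _ => ?_
    rw [← hσ]
    simp
  unfold mom
  simp_rw [h1]
  rw [hPerm m σ (by rw [hm, aux_sum]; exact he)]
  simp_rw [h2, aux_prod f e]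

theorem aux_S2 {n : ℕ} (a : Fin n → ℝ) (ha : ∑ i, a i = 1) (c0 c1 : ℝ)
    (d : Fin n → Fin n → ℝ) (hd : d = fun i j => if i = j then 1 else 0) :
    ∑ i, ∑ j, a i * a j * (c0 + c1 * d i j) = c0 + c1 * Spow a 2 := by
  have hs : ∀ (i : Fin n) (g : Fin n → ℝ), ∑ j, d i j * g j = g i := by
    intro i g
    simp [hd]
  have hsum1 : ∀ c : ℝ, ∑ i, c * a i = c := by
    intro c; rw [← Finset.mul_sum, ha, mul_one]
  have k1 : ∀ i, ∑ j, a i * a j * (c0 + c1 * d i j) = c0 * a i + c1 * a i ^ 2 := by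
    intro i
    have : ∀ j, a i * a j * (c0 + c1 * d i j) = a i * c0 * a j + d i j * (a i * a j * c1) := by
      intro j; ring
    simp_rw [this, Finset.sum_add_distrib, hs, hsum1]
    ring
  simp_rw [k1, Finset.sum_add_distrib, hsum1, ← Finset.mul_sum, Spow]

theorem aux_S3 {n : ℕ} (a : Fin n → ℝ) (ha : ∑ i, a i = 1) (c0 c1 c2 : ℝ)
    (d : Fin n → Fin n → ℝ) (hd : d = fun i j => if i = j then 1 else 0) :
    ∑ i, ∑ j, ∑ k, a i * a j * a k *
      (c0 + c1 * (d i j + d i k + d j k) + c2 * (d i j * d j k)) =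
      c0 + 3 * c1 * Spow a 2 + c2 * Spow a 3 := by
  have hs : ∀ (i : Fin n) (g : Fin n → ℝ), ∑ j, d i j * g j = g i := by
    intro i g
    simp [hd]
  have hsum1 : ∀ c : ℝ, ∑ i, c * a i = c := by
    intro c; rw [← Finset.mul_sum, ha, mul_one]
  have k1 : ∀ i j, ∑ k, a i * a j * a k *
      (c0 + c1 * (d i j + d i k + d j k) + c2 * (d i j * d j k)) =
      a i * a j * (c0 + c1 * (d i j + a i + a j) + c2 * (d i j * a j)) := by
    intro i j
    have : ∀ k, a i * a j * a k *
      (c0 + c1 * (d i j + d i k + d j k) + c2 * (d i j * d j k)) =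
        a i * a j * (c0 + c1 * d i j) * a k + d i k * (a i * a j * a k * c1)
        + d j k * (a i * a j * a k * (c1 + c2 * d i j)) := by
      intro k; ring
    simp_rw [this, Finset.sum_add_distrib, hs, hsum1]
    ring
  have k2 : ∀ i, ∑ j, a i * a j * (c0 + c1 * (d i j + a i + a j) + c2 * (d i j * a j)) =
      (c0 + c1 * Spow a 2) * a i + 2 * c1 * a i ^ 2 + c2 * a i ^ 3 := by
    intro i
    have : ∀ j, a i * a j * (c0 + c1 * (d i j + a i + a j) + c2 * (d i j * a j)) =
        a i * (c0 + c1 * a i) * a j + a i * c1 * a j ^ 2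
        + d i j * (a i * a j * (c1 + c2 * a j)) := by
      intro j; ring
    simp_rw [this, Finset.sum_add_distrib, hs, hsum1, ← Finset.mul_sum, Spow]
    ring
  simp_rw [k1, k2, Finset.sum_add_distrib, hsum1, ← Finset.mul_sum, Spow]
  ring

theorem aux_S4 {n : ℕ} (a : Fin n → ℝ) (ha : ∑ i, a i = 1) (c0 c1 c2 c3 c4 : ℝ)
    (d : Fin n → Fin n → ℝ) (hd : d = fun i j => if i = j then 1 else 0) :
    ∑ i, ∑ j, ∑ k, ∑ l, a i * a j * a k * a l *
      (c0 + c1 * (d i j + d i k + d i l + d j k + d j l + d k l)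
        + c2 * (d i j * d k l + d i k * d j l + d i l * d j k)
        + c3 * (d i j * d j k + d i j * d j l + d i k * d k l + d j k * d k l)
        + c4 * (d i j * d j k * d k l)) =
      c0 + 6 * c1 * Spow a 2 + 3 * c2 * Spow a 2 ^ 2 + 4 * c3 * Spow a 3 + c4 * Spow a 4 := by
  have hs : ∀ (i : Fin n) (g : Fin n → ℝ), ∑ j, d i j * g j = g i := by
    intro i g
    simp [hd]
  have hsum1 : ∀ c : ℝ, ∑ i, c * a i = c := by
    intro c; rw [← Finset.mul_sum, ha, mul_one]
  have k1 : ∀ i j k, ∑ l, a i * a j * a k * a l *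
      (c0 + c1 * (d i j + d i k + d i l + d j k + d j l + d k l)
        + c2 * (d i j * d k l + d i k * d j l + d i l * d j k)
        + c3 * (d i j * d j k + d i j * d j l + d i k * d k l + d j k * d k l)
        + c4 * (d i j * d j k * d k l)) =
      a i * a j * a k * (c0 + c1 * (d i j + d i k + d j k + a i + a j + a k)
        + c2 * (d i j * a k + d i k * a j + d j k * a i)
        + c3 * (d i j * d j k + d i j * a j + d i k * a k + d j k * a k)
        + c4 * (d i j * d j k * a k)) := by
    intro i j k
    have : ∀ l, a i * a j * a k * a l *
      (c0 + c1 * (d i j + d i k + d i l + d j k + d j l + d k l)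
        + c2 * (d i j * d k l + d i k * d j l + d i l * d j k)
        + c3 * (d i j * d j k + d i j * d j l + d i k * d k l + d j k * d k l)
        + c4 * (d i j * d j k * d k l)) =
        a i * a j * a k * (c0 + c1 * (d i j + d i k + d j k) + c3 * (d i j * d j k)) * a l
        + d i l * (a i * a j * a k * (c1 + c2 * d j k) * a l)
        + d j l * (a i * a j * a k * (c1 + c2 * d i k + c3 * d i j) * a l)
        + d k l * (a i * a j * a k * (c1 + c2 * d i j + c3 * (d i k + d j k)
            + c4 * (d i j * d j k)) * a l) := by
      intro l; ring
    simp_rw [this, Finset.sum_add_distrib, hs, hsum1]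
    ring
  simp_rw [k1]
  have k2 : ∀ i j, ∑ k, a i * a j * a k * (c0 + c1 * (d i j + d i k + d j k + a i + a j + a k)
        + c2 * (d i j * a k + d i k * a j + d j k * a i)
        + c3 * (d i j * d j k + d i j * a j + d i k * a k + d j k * a k)
        + c4 * (d i j * d j k * a k)) =
      a i * a j * (c0 + c1 * (d i j + 2 * a i + 2 * a j + Spow a 2)
        + c2 * (d i j * Spow a 2 + 2 * a i * a j)
        + c3 * (2 * d i j * a j + a i ^ 2 + a j ^ 2)
        + c4 * (d i j * a j ^ 2)) := by
    intro i j
    have : ∀ k, a i * a j * a k * (c0 + c1 * (d i j + d i k + d j k + a i + a j + a k)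
        + c2 * (d i j * a k + d i k * a j + d j k * a i)
        + c3 * (d i j * d j k + d i j * a j + d i k * a k + d j k * a k)
        + c4 * (d i j * d j k * a k)) =
        a i * a j * (c0 + c1 * (d i j + a i + a j) + c3 * (d i j * a j)) * a k
        + a i * a j * (c1 + c2 * d i j) * a k ^ 2
        + d i k * (a i * a j * a k * (c1 + c2 * a j + c3 * a k))
        + d j k * (a i * a j * a k * (c1 + c2 * a i + c3 * (d i j + a k)
          + c4 * (d i j * a k))) := by
      intro k; ring
    simp_rw [this, Finset.sum_add_distrib, hs, hsum1, ← Finset.mul_sum, Spow]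
    ring
  simp_rw [k2]
  have k3 : ∀ i, ∑ j, a i * a j * (c0 + c1 * (d i j + 2 * a i + 2 * a j + Spow a 2)
        + c2 * (d i j * Spow a 2 + 2 * a i * a j)
        + c3 * (2 * d i j * a j + a i ^ 2 + a j ^ 2)
        + c4 * (d i j * a j ^ 2)) =
      (c0 + 3 * c1 * Spow a 2 + c3 * Spow a 3) * a i
       + (3 * c1 + 3 * c2 * Spow a 2) * a i ^ 2 + 3 * c3 * a i ^ 3 + c4 * a i ^ 4 := by
    intro i
    have : ∀ j, a i * a j * (c0 + c1 * (d i j + 2 * a i + 2 * a j + Spow a 2)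
        + c2 * (d i j * Spow a 2 + 2 * a i * a j)
        + c3 * (2 * d i j * a j + a i ^ 2 + a j ^ 2)
        + c4 * (d i j * a j ^ 2)) =
        a i * (c0 + c1 * (2 * a i + Spow a 2) + c3 * a i ^ 2) * a j
        + a i * (2 * c1 + 2 * c2 * a i) * a j ^ 2
        + a i * c3 * a j ^ 3
        + d i j * (a i * a j * (c1 + c2 * Spow a 2 + 2 * c3 * a j + c4 * a j ^ 2)) := by
      intro j; ring
    simp_rw [this, Finset.sum_add_distrib, hs, hsum1, ← Finset.mul_sum, Spow]
    ring
  simp_rw [k3, Finset.sum_add_distrib, hsum1, ← Finset.mul_sum, Spow]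
  ring

set_option maxHeartbeats 8000000 in
/-- Exact fourth moment of a centered weighted sum of squares. -/
theorem fourth_moment_centered_weighted_sum
    (P : Measure Ω) [IsProbabilityMeasure P]
    (n : ℕ) (hn : 4 ≤ n) (Z : Fin n → Ω → ℝ)
    (hInt : ∀ m : Fin n → ℕ, (∑ i, m i) ≤ 4 →
      Integrable (fun ω => ∏ i, Z i ω ^ (2 * m i)) P)
    (hPerm : ∀ (m : Fin n → ℕ) (σ : Equiv.Perm (Fin n)), (∑ i, m i) ≤ 4 →
      ∫ ω, ∏ i, Z i ω ^ (2 * m i) ∂P = ∫ ω, ∏ i, Z i ω ^ (2 * m (σ i)) ∂P)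
    (a : Fin n → ℝ) (ha : ∑ i, a i = 1) :
    ∫ ω, (∑ k, a k * ((Z k ω) ^ 2 - ∫ ω', (Z k ω') ^ 2 ∂P)) ^ 4 ∂P =
      Spow a 4 * mom P Z [4] + 4 * (Spow a 3 - Spow a 4) * mom P Z [3, 1] -
        4 * Spow a 3 * mom P Z [1] * mom P Z [3] +
        3 * ((Spow a 2) ^ 2 - Spow a 4) * mom P Z [2, 2] +
        6 * (Spow a 2 - (Spow a 2) ^ 2 - 2 * Spow a 3 + 2 * Spow a 4) * mom P Z [2, 1, 1] +
        12 * (-Spow a 2 + Spow a 3) * mom P Z [1] * mom P Z [2, 1] +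
        4 * (3 * Spow a 2 - 2 * Spow a 3 - 1) * mom P Z [1] * mom P Z [1, 1, 1] +
        (-6 * Spow a 2 + 3 * (Spow a 2) ^ 2 + 8 * Spow a 3 - 6 * Spow a 4 + 1) *
          mom P Z [1, 1, 1, 1] +
        6 * (1 - Spow a 2) * (mom P Z [1]) ^ 2 * mom P Z [1, 1] +
        6 * Spow a 2 * (mom P Z [1]) ^ 2 * mom P Z [2] - 3 * (mom P Z [1]) ^ 4 := by
  have h1 : ∀ p : Fin n, ∫ ω, Z p ω ^ (2 * 1) ∂P = mom P Z [1] := by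
    intro p
    have := aux_mom P Z hPerm ![p] (by
      intro x y hxy
      fin_cases x <;> fin_cases y <;> simp_all) ![1] (by simp [Fin.sum_univ_succ])
    simpa [Fin.prod_univ_succ, mul_assoc] using this
  have h2 : ∀ p : Fin n, ∫ ω, Z p ω ^ (2 * 2) ∂P = mom P Z [2] := by
    intro p
    have := aux_mom P Z hPerm ![p] (by
      intro x y hxy
      fin_cases x <;> fin_cases y <;> simp_all) ![2] (by simp [Fin.sum_univ_succ])
    simpa [Fin.prod_univ_succ, mul_assoc] using this
  have h11 : ∀ p q : Fin n, p ≠ q → ∫ ω, Z p ω ^ (2 * 1) * Z q ω ^ (2 * 1) ∂P = mom P Z [1, 1] := by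
    intro p q n0
    have := aux_mom P Z hPerm ![p, q] (by
      intro x y hxy
      fin_cases x <;> fin_cases y <;> simp_all) ![1, 1] (by simp [Fin.sum_univ_succ])
    simpa [Fin.prod_univ_succ, mul_assoc] using this
  have h3 : ∀ p : Fin n, ∫ ω, Z p ω ^ (2 * 3) ∂P = mom P Z [3] := by
    intro p
    have := aux_mom P Z hPerm ![p] (by
      intro x y hxy
      fin_cases x <;> fin_cases y <;> simp_all) ![3] (by simp [Fin.sum_univ_succ])
    simpa [Fin.prod_univ_succ, mul_assoc] using this
  have h21 : ∀ p q : Fin n, p ≠ q → ∫ ω, Z p ω ^ (2 * 2) * Z q ω ^ (2 * 1) ∂P = mom P Z [2, 1] := by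
    intro p q n0
    have := aux_mom P Z hPerm ![p, q] (by
      intro x y hxy
      fin_cases x <;> fin_cases y <;> simp_all) ![2, 1] (by simp [Fin.sum_univ_succ])
    simpa [Fin.prod_univ_succ, mul_assoc] using this
  have h111 : ∀ p q r : Fin n, p ≠ q → p ≠ r → q ≠ r → ∫ ω, Z p ω ^ (2 * 1) * Z q ω ^ (2 * 1) * Z r ω ^ (2 * 1) ∂P = mom P Z [1, 1, 1] := by
    intro p q r n0 n1 n2
    have := aux_mom P Z hPerm ![p, q, r] (by
      intro x y hxy
      fin_cases x <;> fin_cases y <;> simp_all) ![1, 1, 1] (by simp [Fin.sum_univ_succ])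
    simpa [Fin.prod_univ_succ, mul_assoc] using this
  have h4 : ∀ p : Fin n, ∫ ω, Z p ω ^ (2 * 4) ∂P = mom P Z [4] := by
    intro p
    have := aux_mom P Z hPerm ![p] (by
      intro x y hxy
      fin_cases x <;> fin_cases y <;> simp_all) ![4] (by simp [Fin.sum_univ_succ])
    simpa [Fin.prod_univ_succ, mul_assoc] using this
  have h31 : ∀ p q : Fin n, p ≠ q → ∫ ω, Z p ω ^ (2 * 3) * Z q ω ^ (2 * 1) ∂P = mom P Z [3, 1] := by
    intro p q n0
    have := aux_mom P Z hPerm ![p, q] (by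
      intro x y hxy
      fin_cases x <;> fin_cases y <;> simp_all) ![3, 1] (by simp [Fin.sum_univ_succ])
    simpa [Fin.prod_univ_succ, mul_assoc] using this
  have h22 : ∀ p q : Fin n, p ≠ q → ∫ ω, Z p ω ^ (2 * 2) * Z q ω ^ (2 * 2) ∂P = mom P Z [2, 2] := by
    intro p q n0
    have := aux_mom P Z hPerm ![p, q] (by
      intro x y hxy
      fin_cases x <;> fin_cases y <;> simp_all) ![2, 2] (by simp [Fin.sum_univ_succ])
    simpa [Fin.prod_univ_succ, mul_assoc] using this
  have h211 : ∀ p q r : Fin n, p ≠ q → p ≠ r → q ≠ r → ∫ ω, Z p ω ^ (2 * 2) * Z q ω ^ (2 * 1) * Z r ω ^ (2 * 1) ∂P = mom P Z [2, 1, 1] := by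
    intro p q r n0 n1 n2
    have := aux_mom P Z hPerm ![p, q, r] (by
      intro x y hxy
      fin_cases x <;> fin_cases y <;> simp_all) ![2, 1, 1] (by simp [Fin.sum_univ_succ])
    simpa [Fin.prod_univ_succ, mul_assoc] using this
  have h1111 : ∀ p q r s : Fin n, p ≠ q → p ≠ r → p ≠ s → q ≠ r → q ≠ s → r ≠ s → ∫ ω, Z p ω ^ (2 * 1) * Z q ω ^ (2 * 1) * Z r ω ^ (2 * 1) * Z s ω ^ (2 * 1) ∂P = mom P Z [1, 1, 1, 1] := by
    intro p q r s n0 n1 n2 n3 n4 n5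
    have := aux_mom P Z hPerm ![p, q, r, s] (by
      intro x y hxy
      fin_cases x <;> fin_cases y <;> simp_all) ![1, 1, 1, 1] (by simp [Fin.sum_univ_succ])
    simpa [Fin.prod_univ_succ, mul_assoc] using this
  set b1 := mom P Z [1]
  set b2 := mom P Z [2]
  set b11 := mom P Z [1, 1]
  set b3 := mom P Z [3]
  set b21 := mom P Z [2, 1]
  set b111 := mom P Z [1, 1, 1]
  set b4 := mom P Z [4]
  set b31 := mom P Z [3, 1]
  set b22 := mom P Z [2, 2]
  set b211 := mom P Z [2, 1, 1]
  set b1111 := mom P Z [1, 1, 1, 1]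
  obtain ⟨d, hd⟩ : ∃ d : Fin n → Fin n → ℝ, d = fun i j => if i = j then 1 else 0 := ⟨_, rfl⟩
  have hone : ∀ i, d i i = 1 := by simp [hd]
  have hz : ∀ i j, i ≠ j → d i j = 0 := by
    intro i j h
    simp [hd, h]
  have hM1 : ∀ i, ∫ ω, Z i ω ^ 2 ∂P = b1 := fun i => by simpa using h1 i
  have hM2 : ∀ i j, ∫ ω, Z i ω ^ 2 * Z j ω ^ 2 ∂P = b11 + (b2 - b11) * d i j := by
    intro i j
    by_cases hij : i = j
    · subst hij
      have e := h2 i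
      simp only [hone]
      refine Eq.trans (Eq.trans ?_ e) ?_
      · congr 1 <;> (ext ω; ring)
      · ring
    have e := h11 i j (by tauto)
    have z0 := hz i j (by tauto)
    have z1 := hz j i (by tauto)
    simp only [hone, z0, z1]
    refine Eq.trans (Eq.trans ?_ e) ?_
    · congr 1 <;> (ext ω; ring)
    · ring
  have hM3 : ∀ i j k, ∫ ω, Z i ω ^ 2 * Z j ω ^ 2 * Z k ω ^ 2 ∂P =
      b111 + (b21 - b111) * (d i j + d i k + d j k)
        + (b3 - 3 * b21 + 2 * b111) * (d i j * d j k) := by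
    intro i j k
    by_cases hij : i = j
    · subst hij
      by_cases hik : i = k
      · subst hik
        have e := h3 i
        simp only [hone]
        refine Eq.trans (Eq.trans ?_ e) ?_
        · congr 1 <;> (ext ω; ring)
        · ring
      have e := h21 i k (by tauto)
      have z0 := hz i k (by tauto)
      have z1 := hz k i (by tauto)
      simp only [hone, z0, z1]
      refine Eq.trans (Eq.trans ?_ e) ?_
      · congr 1 <;> (ext ω; ring)
      · ring
    by_cases hik : i = k
    · subst hik
      have e := h21 i j (by tauto)
      have z0 := hz i j (by tauto)
      have z1 := hz j i (by tauto)
      simp only [hone, z0, z1]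
      refine Eq.trans (Eq.trans ?_ e) ?_
      · congr 1 <;> (ext ω; ring)
      · ring
    by_cases hjk : j = k
    · subst hjk
      have e := h21 j i (by tauto)
      have z0 := hz i j (by tauto)
      have z1 := hz j i (by tauto)
      simp only [hone, z0, z1]
      refine Eq.trans (Eq.trans ?_ e) ?_
      · congr 1 <;> (ext ω; ring)
      · ring
    have e := h111 i j k (by tauto) (by tauto) (by tauto)
    have z0 := hz i j (by tauto)
    have z1 := hz i k (by tauto)
    have z2 := hz j i (by tauto)
    have z3 := hz j k (by tauto)
    have z4 := hz k i (by tauto)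
    have z5 := hz k j (by tauto)
    simp only [hone, z0, z1, z2, z3, z4, z5]
    refine Eq.trans (Eq.trans ?_ e) ?_
    · congr 1 <;> (ext ω; ring)
    · ring
  have hM4 : ∀ i j k l, ∫ ω, Z i ω ^ 2 * Z j ω ^ 2 * Z k ω ^ 2 * Z l ω ^ 2 ∂P =
      b1111 + (b211 - b1111) * (d i j + d i k + d i l + d j k + d j l + d k l)
        + (b22 - 2 * b211 + b1111) * (d i j * d k l + d i k * d j l + d i l * d j k)
        + (b31 - 3 * b211 + 2 * b1111) *
          (d i j * d j k + d i j * d j l + d i k * d k l + d j k * d k l)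
        + (b4 - 4 * b31 - 3 * b22 + 12 * b211 - 6 * b1111) * (d i j * d j k * d k l) := by
    intro i j k l
    by_cases hij : i = j
    · subst hij
      by_cases hik : i = k
      · subst hik
        by_cases hil : i = l
        · subst hil
          have e := h4 i
          simp only [hone]
          refine Eq.trans (Eq.trans ?_ e) ?_
          · congr 1 <;> (ext ω; ring)
          · ring
        have e := h31 i l (by tauto)
        have z0 := hz i l (by tauto)
        have z1 := hz l i (by tauto)
        simp only [hone, z0, z1]
        refine Eq.trans (Eq.trans ?_ e) ?_
        · congr 1 <;> (ext ω; ring)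
        · ring
      by_cases hil : i = l
      · subst hil
        have e := h31 i k (by tauto)
        have z0 := hz i k (by tauto)
        have z1 := hz k i (by tauto)
        simp only [hone, z0, z1]
        refine Eq.trans (Eq.trans ?_ e) ?_
        · congr 1 <;> (ext ω; ring)
        · ring
      by_cases hkl : k = l
      · subst hkl
        have e := h22 i k (by tauto)
        have z0 := hz i k (by tauto)
        have z1 := hz k i (by tauto)
        simp only [hone, z0, z1]
        refine Eq.trans (Eq.trans ?_ e) ?_
        · congr 1 <;> (ext ω; ring)
        · ring
      have e := h211 i k l (by tauto) (by tauto) (by tauto)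
      have z0 := hz i k (by tauto)
      have z1 := hz i l (by tauto)
      have z2 := hz k i (by tauto)
      have z3 := hz k l (by tauto)
      have z4 := hz l i (by tauto)
      have z5 := hz l k (by tauto)
      simp only [hone, z0, z1, z2, z3, z4, z5]
      refine Eq.trans (Eq.trans ?_ e) ?_
      · congr 1 <;> (ext ω; ring)
      · ring
    by_cases hik : i = k
    · subst hik
      by_cases hil : i = l
      · subst hil
        have e := h31 i j (by tauto)
        have z0 := hz i j (by tauto)
        have z1 := hz j i (by tauto)
        simp only [hone, z0, z1]
        refine Eq.trans (Eq.trans ?_ e) ?_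
        · congr 1 <;> (ext ω; ring)
        · ring
      by_cases hjl : j = l
      · subst hjl
        have e := h22 i j (by tauto)
        have z0 := hz i j (by tauto)
        have z1 := hz j i (by tauto)
        simp only [hone, z0, z1]
        refine Eq.trans (Eq.trans ?_ e) ?_
        · congr 1 <;> (ext ω; ring)
        · ring
      have e := h211 i j l (by tauto) (by tauto) (by tauto)
      have z0 := hz i j (by tauto)
      have z1 := hz i l (by tauto)
      have z2 := hz j i (by tauto)
      have z3 := hz j l (by tauto)
      have z4 := hz l i (by tauto)
      have z5 := hz l j (by tauto)
      simp only [hone, z0, z1, z2, z3, z4, z5]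
      refine Eq.trans (Eq.trans ?_ e) ?_
      · congr 1 <;> (ext ω; ring)
      · ring
    by_cases hjk : j = k
    · subst hjk
      by_cases hil : i = l
      · subst hil
        have e := h22 i j (by tauto)
        have z0 := hz i j (by tauto)
        have z1 := hz j i (by tauto)
        simp only [hone, z0, z1]
        refine Eq.trans (Eq.trans ?_ e) ?_
        · congr 1 <;> (ext ω; ring)
        · ring
      by_cases hjl : j = l
      · subst hjl
        have e := h31 j i (by tauto)
        have z0 := hz i j (by tauto)
        have z1 := hz j i (by tauto)
        simp only [hone, z0, z1]
        refine Eq.trans (Eq.trans ?_ e) ?_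
        · congr 1 <;> (ext ω; ring)
        · ring
      have e := h211 j i l (by tauto) (by tauto) (by tauto)
      have z0 := hz i j (by tauto)
      have z1 := hz i l (by tauto)
      have z2 := hz j i (by tauto)
      have z3 := hz j l (by tauto)
      have z4 := hz l i (by tauto)
      have z5 := hz l j (by tauto)
      simp only [hone, z0, z1, z2, z3, z4, z5]
      refine Eq.trans (Eq.trans ?_ e) ?_
      · congr 1 <;> (ext ω; ring)
      · ring
    by_cases hil : i = l
    · subst hil
      have e := h211 i j k (by tauto) (by tauto) (by tauto)
      have z0 := hz i j (by tauto)
      have z1 := hz i k (by tauto)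
      have z2 := hz j i (by tauto)
      have z3 := hz j k (by tauto)
      have z4 := hz k i (by tauto)
      have z5 := hz k j (by tauto)
      simp only [hone, z0, z1, z2, z3, z4, z5]
      refine Eq.trans (Eq.trans ?_ e) ?_
      · congr 1 <;> (ext ω; ring)
      · ring
    by_cases hjl : j = l
    · subst hjl
      have e := h211 j i k (by tauto) (by tauto) (by tauto)
      have z0 := hz i j (by tauto)
      have z1 := hz i k (by tauto)
      have z2 := hz j i (by tauto)
      have z3 := hz j k (by tauto)
      have z4 := hz k i (by tauto)
      have z5 := hz k j (by tauto)
      simp only [hone, z0, z1, z2, z3, z4, z5]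
      refine Eq.trans (Eq.trans ?_ e) ?_
      · congr 1 <;> (ext ω; ring)
      · ring
    by_cases hkl : k = l
    · subst hkl
      have e := h211 k i j (by tauto) (by tauto) (by tauto)
      have z0 := hz i j (by tauto)
      have z1 := hz i k (by tauto)
      have z2 := hz j i (by tauto)
      have z3 := hz j k (by tauto)
      have z4 := hz k i (by tauto)
      have z5 := hz k j (by tauto)
      simp only [hone, z0, z1, z2, z3, z4, z5]
      refine Eq.trans (Eq.trans ?_ e) ?_
      · congr 1 <;> (ext ω; ring)
      · ring
    have e := h1111 i j k l (by tauto) (by tauto) (by tauto) (by tauto) (by tauto) (by tauto)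
    have z0 := hz i j (by tauto)
    have z1 := hz i k (by tauto)
    have z2 := hz i l (by tauto)
    have z3 := hz j i (by tauto)
    have z4 := hz j k (by tauto)
    have z5 := hz j l (by tauto)
    have z6 := hz k i (by tauto)
    have z7 := hz k j (by tauto)
    have z8 := hz k l (by tauto)
    have z9 := hz l i (by tauto)
    have z10 := hz l j (by tauto)
    have z11 := hz l k (by tauto)
    simp only [hone, z0, z1, z2, z3, z4, z5, z6, z7, z8, z9, z10, z11]
    refine Eq.trans (Eq.trans ?_ e) ?_
    · congr 1 <;> (ext ω; ring)
    · ring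
  have I1 : ∀ i, Integrable (fun ω => Z i ω ^ 2) P := fun i => by
    simpa using aux_int P Z hInt ![i] (by norm_num)
  have I2 : ∀ i j, Integrable (fun ω => Z i ω ^ 2 * Z j ω ^ 2) P := fun i j => by
    simpa [Fin.prod_univ_succ] using aux_int P Z hInt ![i, j] (by norm_num)
  have I3 : ∀ i j k, Integrable (fun ω => Z i ω ^ 2 * Z j ω ^ 2 * Z k ω ^ 2) P := fun i j k => by
    simpa [Fin.prod_univ_succ, mul_assoc] using aux_int P Z hInt ![i, j, k] (by norm_num)
  have I4 : ∀ i j k l, Integrable (fun ω => Z i ω ^ 2 * Z j ω ^ 2 * Z k ω ^ 2 * Z l ω ^ 2) P :=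
    fun i j k l => by
    simpa [Fin.prod_univ_succ, mul_assoc] using aux_int P Z hInt ![i, j, k, l] (by norm_num)
  set W : Ω → ℝ := fun ω => ∑ i, a i * Z i ω ^ 2 with hW
  have W2 : ∀ ω, W ω ^ 2 = ∑ i, ∑ j, a i * a j * (Z i ω ^ 2 * Z j ω ^ 2) := by
    intro ω
    rw [pow_two, hW]
    simp only [Finset.sum_mul_sum]
    refine Finset.sum_congr rfl fun i _ => Finset.sum_congr rfl fun j _ => ?_
    ring
  have W3 : ∀ ω, W ω ^ 3 = ∑ i, ∑ j, ∑ k, a i * a j * a k *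
      (Z i ω ^ 2 * Z j ω ^ 2 * Z k ω ^ 2) := by
    intro ω
    rw [pow_succ, W2, hW]
    simp only [Finset.sum_mul]
    refine Finset.sum_congr rfl fun i _ => Finset.sum_congr rfl fun j _ => ?_
    rw [Finset.mul_sum]
    refine Finset.sum_congr rfl fun k _ => ?_
    ring
  have W4 : ∀ ω, W ω ^ 4 = ∑ i, ∑ j, ∑ k, ∑ l, a i * a j * a k * a l *
      (Z i ω ^ 2 * Z j ω ^ 2 * Z k ω ^ 2 * Z l ω ^ 2) := by
    intro ω
    rw [pow_succ, W3, hW]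
    simp only [Finset.sum_mul]
    refine Finset.sum_congr rfl fun i _ => Finset.sum_congr rfl fun j _ =>
      Finset.sum_congr rfl fun k _ => ?_
    rw [Finset.mul_sum]
    refine Finset.sum_congr rfl fun l _ => ?_
    ring
  have J1 : Integrable W P := integrable_finsetSum _ fun i _ => (I1 i).const_mul _
  have J2 : Integrable (fun ω => W ω ^ 2) P := by
    simp_rw [W2]
    exact integrable_finsetSum _ fun i _ => integrable_finsetSum _ fun j _ => (I2 i j).const_mul _
  have J3 : Integrable (fun ω => W ω ^ 3) P := by
    simp_rw [W3]
    exact integrable_finsetSum _ fun i _ => integrable_finsetSum _ fun j _ =>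
      integrable_finsetSum _ fun k _ => (I3 i j k).const_mul _
  have J4 : Integrable (fun ω => W ω ^ 4) P := by
    simp_rw [W4]
    exact integrable_finsetSum _ fun i _ => integrable_finsetSum _ fun j _ =>
      integrable_finsetSum _ fun k _ => integrable_finsetSum _ fun l _ => (I4 i j k l).const_mul _
  have E1 : ∫ ω, W ω ∂P = b1 := by
    rw [hW, integral_finsetSum _ fun i _ => (I1 i).const_mul _]
    simp_rw [integral_const_mul, hM1, ← Finset.sum_mul, ha, one_mul]
  have E2 : ∫ ω, W ω ^ 2 ∂P = b11 + (b2 - b11) * Spow a 2 := by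
    rw [← aux_S2 a ha _ _ d hd]
    simp_rw [W2, ← hM2, ← integral_const_mul]
    rw [integral_finsetSum _ fun i _ => integrable_finsetSum _ fun j _ => (I2 i j).const_mul _]
    refine Finset.sum_congr rfl fun i _ => ?_
    rw [integral_finsetSum _ fun j _ => (I2 i j).const_mul _]
  have E3 : ∫ ω, W ω ^ 3 ∂P = b111 + 3 * (b21 - b111) * Spow a 2
      + (b3 - 3 * b21 + 2 * b111) * Spow a 3 := by
    rw [← aux_S3 a ha _ _ _ d hd]
    simp_rw [W3, ← hM3, ← integral_const_mul]
    rw [integral_finsetSum _ fun i _ => integrable_finsetSum _ fun j _ =>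
      integrable_finsetSum _ fun k _ => (I3 i j k).const_mul _]
    refine Finset.sum_congr rfl fun i _ => ?_
    rw [integral_finsetSum _ fun j _ =>
      integrable_finsetSum _ fun k _ => (I3 i j k).const_mul _]
    refine Finset.sum_congr rfl fun j _ => ?_
    rw [integral_finsetSum _ fun k _ => (I3 i j k).const_mul _]
  have E4 : ∫ ω, W ω ^ 4 ∂P = b1111 + 6 * (b211 - b1111) * Spow a 2
      + 3 * (b22 - 2 * b211 + b1111) * Spow a 2 ^ 2
      + 4 * (b31 - 3 * b211 + 2 * b1111) * Spow a 3
      + (b4 - 4 * b31 - 3 * b22 + 12 * b211 - 6 * b1111) * Spow a 4 := by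
    rw [← aux_S4 a ha _ _ _ _ _ d hd]
    simp_rw [W4, ← hM4, ← integral_const_mul]
    rw [integral_finsetSum _ fun i _ => integrable_finsetSum _ fun j _ =>
      integrable_finsetSum _ fun k _ => integrable_finsetSum _ fun l _ =>
        (I4 i j k l).const_mul _]
    refine Finset.sum_congr rfl fun i _ => ?_
    rw [integral_finsetSum _ fun j _ =>
      integrable_finsetSum _ fun k _ => integrable_finsetSum _ fun l _ =>
        (I4 i j k l).const_mul _]
    refine Finset.sum_congr rfl fun j _ => ?_
    rw [integral_finsetSum _ fun k _ => integrable_finsetSum _ fun l _ =>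
        (I4 i j k l).const_mul _]
    refine Finset.sum_congr rfl fun k _ => ?_
    rw [integral_finsetSum _ fun l _ => (I4 i j k l).const_mul _]
  have hexp : ∀ ω, (∑ k, a k * ((Z k ω) ^ 2 - ∫ ω', (Z k ω') ^ 2 ∂P)) ^ 4 =
      W ω ^ 4 + (-4 * b1) * W ω ^ 3 + (6 * b1 ^ 2) * W ω ^ 2 + (-4 * b1 ^ 3) * W ω + b1 ^ 4 := by
    intro ω
    have : ∑ k, a k * ((Z k ω) ^ 2 - ∫ ω', (Z k ω') ^ 2 ∂P) = W ω - b1 := by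
      simp_rw [hM1, mul_sub, Finset.sum_sub_distrib, ← Finset.sum_mul, ha, one_mul, hW]
    rw [this]
    ring
  simp_rw [hexp]
  have K3 : Integrable (fun ω => W ω ^ 4 + (-4 * b1) * W ω ^ 3) P := J4.add (J3.const_mul _)
  have K2 : Integrable (fun ω => W ω ^ 4 + (-4 * b1) * W ω ^ 3 + (6 * b1 ^ 2) * W ω ^ 2) P :=
    K3.add (J2.const_mul _)
  have K1 : Integrable (fun ω => W ω ^ 4 + (-4 * b1) * W ω ^ 3 + (6 * b1 ^ 2) * W ω ^ 2
      + (-4 * b1 ^ 3) * W ω) P := K2.add (J1.const_mul _)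
  rw [integral_add K1 (integrable_const _), integral_add K2 (J1.const_mul _),
    integral_add K3 (J2.const_mul _), integral_add J4 (J3.const_mul _)]
  simp only [integral_const_mul, E1, E2, E3, E4, integral_const, probReal_univ, one_smul]
  ring
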